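/- Let φ be a repulsive, tempered potential on ℝ^d with C_φ > 0, let Ω ⊂ ℂ be an open set containing [0, e/C_φ) and p : Ω → ℂ an analytic function such that for every real λ ∈ [0, e/C_φ), (1/V)·log Z_{Λ_V}(λ) → p(λ) as V → ∞ (where Λ_V is the axis-parallel cube of volume V centered at the origin). Define the infinite volume density ρ_φ(λ) := λ·p′(λ) for real λ ∈ [0, e/C_φ). Then: (i) for every r ∈ [0, (e/(1+e))·(1/C_φ)) there exists λ ∈ [0, e/C_φ) with ρ_φ(λ) = r; and (ii) there exist an open set D ⊂ ℂ containing [0, (e/(1+e))·(1/C_φ)) and an analytic function f : D → ℂ such that f(ρ_φ(λ)) = p(λ) for every real λ ∈ [0, e/C_φ) with ρ_φ(λ) ∈ D. (The pressure is analytic as a function of the density for ρ_φ ∈ [0, (e/(1+e))·(1/C_φ)), Theorem 2.) -/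

import Mathlib

open MeasureTheory Filter

noncomputable section

/-- Euclidean space ℝ^d. -/
abbrev Euc (d : ℕ) := EuclideanSpace ℝ (Fin d)

/-- `e^{-t}` for `t ∈ [0,∞]`, with the convention `e^{-∞} = 0`. -/
def expNeg (t : ENNReal) : ℝ := if t = ⊤ then 0 else Real.exp (-t.toReal)

/-- The Boltzmann pair weight `∏_{1 ≤ i < j ≤ k} e^{-φ(x_i - x_j)}`. -/
def pairWeight {d : ℕ} (φ : Euc d → ENNReal) (k : ℕ) (x : Fin k → Euc d) : ℝ :=
  ∏ p ∈ Finset.univ.filter (fun p : Fin k × Fin k => p.1 < p.2), expNeg (φ (x p.1 - x p.2))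

/-- The grand canonical partition function `Z_Λ(λ)` at constant real activity `λ`. -/
def Zreal {d : ℕ} (φ : Euc d → ENNReal) (Λ : Set (Euc d)) (lam : ℝ) : ℝ :=
  ∑' k : ℕ, lam ^ k / (Nat.factorial k) *
    ∫ x in Set.univ.pi (fun _ : Fin k => Λ), pairWeight φ k x

/-- The axis-parallel cube of volume `V` centered at the origin in ℝ^d. -/
def cube (d : ℕ) (V : ℝ) : Set (Euc d) := {x | ∀ i, |x i| ≤ V ^ (1 / (d : ℝ)) / 2}

section Integrals

lemma expNeg_nonneg (t : ENNReal) : 0 ≤ expNeg t := by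
  unfold expNeg; split_ifs <;> positivity

lemma expNeg_le_one (t : ENNReal) : expNeg t ≤ 1 := by
  unfold expNeg
  split_ifs
  · exact zero_le_one
  · exact Real.exp_le_one_iff.2 (neg_nonpos.2 ENNReal.toReal_nonneg)

lemma measurable_expNeg : Measurable expNeg :=
  Measurable.ite (measurableSet_singleton _) measurable_const
    ENNReal.measurable_toReal.neg.exp

variable {d : ℕ} {φ : Euc d → ENNReal}

/-- The weight `∏ᵢ e^{-φ(y - xᵢ)}` of adding a point `y` to the configuration `x`. -/
def insertWeight (φ : Euc d → ENNReal) {k : ℕ} (x : Fin k → Euc d) (y : Euc d) : ℝ :=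
  ∏ i, expNeg (φ (y - x i))

lemma insertWeight_nonneg {k : ℕ} (x : Fin k → Euc d) (y : Euc d) :
    0 ≤ insertWeight φ x y :=
  Finset.prod_nonneg fun _ _ => expNeg_nonneg _

lemma insertWeight_le_one {k : ℕ} (x : Fin k → Euc d) (y : Euc d) :
    insertWeight φ x y ≤ 1 :=
  Finset.prod_le_one (fun _ _ => expNeg_nonneg _) fun _ _ => expNeg_le_one _

lemma measurable_insertWeight (hφ : Measurable φ) {k : ℕ} :
    Measurable fun q : (Fin k → Euc d) × Euc d => insertWeight φ q.1 q.2 :=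
  Finset.measurable_fun_prod _ fun i _ => measurable_expNeg.comp
    (hφ.comp (measurable_snd.sub ((measurable_pi_apply i).comp measurable_fst)))

lemma insertWeight_cons {k : ℕ} (x : Fin k → Euc d) (y z : Euc d) :
    insertWeight φ (Fin.cons y x : Fin (k + 1) → Euc d) z
      = expNeg (φ (z - y)) * insertWeight φ x z := by
  simp [insertWeight, Fin.prod_univ_succ]

lemma pairWeight_eq_prod_prod (k : ℕ) (x : Fin k → Euc d) :
    pairWeight φ k x = ∏ i, ∏ j, if i < j then expNeg (φ (x i - x j)) else 1 := by
  rw [pairWeight, Finset.prod_filter, ← Finset.univ_product_univ, Finset.prod_product]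

lemma pairWeight_cons (k : ℕ) (x : Fin k → Euc d) (y : Euc d) :
    pairWeight φ (k + 1) (Fin.cons y x : Fin (k + 1) → Euc d)
      = pairWeight φ k x * insertWeight φ x y := by
  simp only [pairWeight_eq_prod_prod, insertWeight]
  simp [Fin.prod_univ_succ, mul_comm]

lemma pairWeight_nonneg (k : ℕ) (x : Fin k → Euc d) : 0 ≤ pairWeight φ k x :=
  Finset.prod_nonneg fun _ _ => expNeg_nonneg _

lemma pairWeight_le_one (k : ℕ) (x : Fin k → Euc d) : pairWeight φ k x ≤ 1 :=
  Finset.prod_le_one (fun _ _ => expNeg_nonneg _) fun _ _ => expNeg_le_one _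

lemma measurable_pairWeight (hφ : Measurable φ) (k : ℕ) : Measurable (pairWeight φ k) :=
  Finset.measurable_fun_prod _ fun p _ => measurable_expNeg.comp
    (hφ.comp ((measurable_pi_apply p.1).sub (measurable_pi_apply p.2)))

lemma integrable_of_mem_unit {α : Type*} [MeasurableSpace α] {μ : Measure α} [IsFiniteMeasure μ]
    {f : α → ℝ} (hf : Measurable f) (h0 : ∀ x, 0 ≤ f x) (h1 : ∀ x, f x ≤ 1) :
    Integrable f μ :=
  Integrable.of_bound hf.aestronglyMeasurable 1
    (Eventually.of_forall fun x => by rw [Real.norm_eq_abs, abs_of_nonneg (h0 x)]; exact h1 x)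

lemma measurable_cons {k : ℕ} : Measurable fun q : Euc d × (Fin k → Euc d) =>
    (Fin.cons q.1 q.2 : Fin (k + 1) → Euc d) := by
  refine measurable_pi_iff.2 fun i => ?_
  refine Fin.cases ?_ (fun j => ?_) i
  · exact measurable_fst
  · exact (measurable_pi_apply j).comp measurable_snd

variable (μ : Measure (Euc d))

/-- The configuration integral of `k` particles with respect to the reference measure `μ`. -/
def configIntegral (φ : Euc d → ENNReal) (μ : Measure (Euc d)) (k : ℕ) : ℝ :=
  ∫ x, pairWeight φ k x ∂Measure.pi (fun _ : Fin k => μ)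

/-- The free volume seen by a point added to the configuration `x`. -/
def freeVolume (φ : Euc d → ENNReal) (μ : Measure (Euc d)) {k : ℕ} (x : Fin k → Euc d) : ℝ :=
  ∫ y, insertWeight φ x y ∂μ

lemma freeVolume_nonneg {k : ℕ} (x : Fin k → Euc d) : 0 ≤ freeVolume φ μ x :=
  integral_nonneg fun _ => insertWeight_nonneg _ _

lemma configIntegral_nonneg (k : ℕ) : 0 ≤ configIntegral φ μ k :=
  integral_nonneg fun _ => pairWeight_nonneg _ _

lemma configIntegral_zero : configIntegral φ μ 0 = 1 := by
  simp [configIntegral, pairWeight, measureReal_def]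

variable [IsFiniteMeasure μ]

lemma integral_pi_succ {k : ℕ} {g : (Fin (k + 1) → Euc d) → ℝ} (hg : Measurable g)
    {M : ℝ} (hM : ∀ x, ‖g x‖ ≤ M) :
    ∫ x, g x ∂Measure.pi (fun _ : Fin (k + 1) => μ)
      = ∫ x, ∫ y, g (Fin.cons y x) ∂μ ∂Measure.pi (fun _ : Fin k => μ) := by
  have e := measurePreserving_piFinSuccAbove (fun _ : Fin (k + 1) => μ) 0
  have h1 := e.integral_comp' (fun q => g (Fin.cons q.1 q.2))
  have h2 : ∀ x : Fin (k + 1) → Euc d,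
      (Fin.cons ((MeasurableEquiv.piFinSuccAbove (fun _ => Euc d) 0) x).1
        ((MeasurableEquiv.piFinSuccAbove (fun _ => Euc d) 0) x).2 : Fin (k + 1) → Euc d) = x := by
    intro x
    exact Fin.cons_self_tail x
  simp only [h2] at h1
  rw [h1]
  have hm : Measurable fun q : Euc d × (Fin k → Euc d) => g (Fin.cons q.1 q.2) :=
    hg.comp measurable_cons
  exact integral_prod_symm _
    (Integrable.of_bound hm.aestronglyMeasurable M (Eventually.of_forall fun q => hM _))

lemma measurable_freeVolume (hφ : Measurable φ) {k : ℕ} :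
    Measurable fun x : Fin k → Euc d => freeVolume φ μ x :=
  ((measurable_insertWeight hφ).stronglyMeasurable.integral_prod_right (ν := μ)).measurable

lemma integrable_insertWeight (hφ : Measurable φ) {k : ℕ} (x : Fin k → Euc d) :
    Integrable (insertWeight φ x) μ :=
  integrable_of_mem_unit ((measurable_insertWeight hφ).comp measurable_prodMk_left)
    (insertWeight_nonneg x) (insertWeight_le_one x)

lemma freeVolume_le (hφ : Measurable φ) {k : ℕ} (x : Fin k → Euc d) :
    freeVolume φ μ x ≤ μ.real Set.univ := by
  have := integral_mono (integrable_insertWeight μ hφ x) (integrable_const (1 : ℝ))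
    (insertWeight_le_one x)
  simpa [freeVolume] using this

lemma configIntegral_succ (hφ : Measurable φ) (k : ℕ) :
    configIntegral φ μ (k + 1)
      = ∫ x, pairWeight φ k x * freeVolume φ μ x ∂Measure.pi (fun _ : Fin k => μ) := by
  rw [configIntegral, integral_pi_succ μ (measurable_pairWeight hφ (k + 1)) (M := 1)]
  · simp only [pairWeight_cons, integral_const_mul, freeVolume]
  · intro x
    rw [Real.norm_eq_abs, abs_of_nonneg (pairWeight_nonneg _ _)]
    exact pairWeight_le_one _ _

lemma configIntegral_one (hφ : Measurable φ) : configIntegral φ μ 1 = μ.real Set.univ := by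
  rw [configIntegral_succ μ hφ 0]
  simp [pairWeight, freeVolume, insertWeight, measureReal_def]

lemma integrable_pairWeight_mul (hφ : Measurable φ) {k : ℕ} {g : (Fin k → Euc d) → ℝ}
    (hg : Measurable g) {M : ℝ} (hM : ∀ x, ‖g x‖ ≤ M) :
    Integrable (fun x => pairWeight φ k x * g x) (Measure.pi (fun _ : Fin k => μ)) := by
  refine Integrable.of_bound ((measurable_pairWeight hφ k).mul hg).aestronglyMeasurable M
    (Eventually.of_forall fun x => ?_)
  rw [norm_mul, Real.norm_eq_abs (pairWeight φ k x), abs_of_nonneg (pairWeight_nonneg _ _)]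
  exact (mul_le_of_le_one_left (norm_nonneg _) (pairWeight_le_one _ _)).trans (hM x)

lemma norm_freeVolume_le (hφ : Measurable φ) {k : ℕ} (x : Fin k → Euc d) :
    ‖freeVolume φ μ x‖ ≤ μ.real Set.univ := by
  rw [Real.norm_eq_abs, abs_of_nonneg (freeVolume_nonneg _ _)]
  exact freeVolume_le μ hφ x

lemma configIntegral_succ_le (hφ : Measurable φ) (k : ℕ) :
    configIntegral φ μ (k + 1) ≤ μ.real Set.univ * configIntegral φ μ k := by
  rw [configIntegral_succ μ hφ, configIntegral, ← integral_const_mul]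
  refine integral_mono (integrable_pairWeight_mul μ hφ (measurable_freeVolume μ hφ)
    (norm_freeVolume_le μ hφ)) (Integrable.const_mul (integrable_of_mem_unit
      (measurable_pairWeight hφ k) (pairWeight_nonneg k) (pairWeight_le_one k)) _) fun x => ?_
  simp only
  rw [mul_comm]
  exact mul_le_mul_of_nonneg_right (freeVolume_le μ hφ x) (pairWeight_nonneg _ _)

lemma configIntegral_le_pow (hφ : Measurable φ) (k : ℕ) :
    configIntegral φ μ k ≤ μ.real Set.univ ^ k := by
  induction k with
  | zero => simp [configIntegral_zero]
  | succ k ih =>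
    rw [pow_succ']
    exact (configIntegral_succ_le μ hφ k).trans
      (mul_le_mul_of_nonneg_left ih measureReal_nonneg)

lemma norm_insertWeight_mul_freeVolume_le (hφ : Measurable φ) {k : ℕ} (x : Fin k → Euc d)
    (y : Euc d) :
    ‖insertWeight φ x y * freeVolume φ μ (Fin.cons y x : Fin (k + 1) → Euc d)‖
      ≤ μ.real Set.univ := by
  rw [norm_mul, Real.norm_eq_abs (insertWeight φ x y), abs_of_nonneg (insertWeight_nonneg _ _)]
  exact (mul_le_of_le_one_left (norm_nonneg _) (insertWeight_le_one _ _)).trans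
    (norm_freeVolume_le μ hφ _)

lemma freeVolume_sq_le (hφ : Measurable φ)
    (hφtemp : Integrable (fun x : Euc d => 1 - expNeg (φ x))) (hμ : μ ≤ volume)
    {k : ℕ} (x : Fin k → Euc d) :
    freeVolume φ μ x ^ 2 ≤ ∫ y, insertWeight φ x y *
        freeVolume φ μ (Fin.cons y x : Fin (k + 1) → Euc d) ∂μ
      + (∫ y : Euc d, (1 - expNeg (φ y))) * freeVolume φ μ x := by
  set C := ∫ y : Euc d, (1 - expNeg (φ y))
  have hcons : Measurable fun y : Euc d => (Fin.cons y x : Fin (k + 1) → Euc d) :=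
    measurable_cons.comp measurable_prodMk_right
  have key : ∀ y, freeVolume φ μ x ≤
      freeVolume φ μ (Fin.cons y x : Fin (k + 1) → Euc d) + C := by
    intro y
    have h1 : Integrable (fun z => 1 - expNeg (φ (z - y))) volume := hφtemp.comp_sub_right y
    have h2 : ∫ z, (1 - expNeg (φ (z - y))) = C :=
      integral_sub_right_eq_self (fun z => 1 - expNeg (φ z)) y
    have h3 : ∫ z, (1 - expNeg (φ (z - y))) ∂μ ≤ C := by
      rw [← h2]
      exact integral_mono_measure hμ
        (Eventually.of_forall fun z => sub_nonneg.2 (expNeg_le_one _)) h1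
    refine le_trans ?_ (add_le_add_right h3 _)
    rw [freeVolume, freeVolume, ← integral_add (integrable_insertWeight μ hφ _)
      (h1.mono_measure hμ)]
    refine integral_mono (integrable_insertWeight μ hφ _)
      ((integrable_insertWeight μ hφ _).add (h1.mono_measure hμ)) fun z => ?_
    simp only [insertWeight_cons]
    nlinarith [expNeg_le_one (φ (z - y)), insertWeight_le_one (φ := φ) x z]
  have hi : Integrable (fun y => insertWeight φ x y *
      freeVolume φ μ (Fin.cons y x : Fin (k + 1) → Euc d)) μ := by
    refine Integrable.of_bound (C := μ.real Set.univ)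
      ((((measurable_insertWeight hφ).comp measurable_prodMk_left).mul
        ((measurable_freeVolume μ hφ).comp hcons)).aestronglyMeasurable)
      (Eventually.of_forall fun y => norm_insertWeight_mul_freeVolume_le μ hφ x y)
  calc freeVolume φ μ x ^ 2 = ∫ y, insertWeight φ x y * freeVolume φ μ x ∂μ := by
        rw [integral_mul_const, sq]; rfl
    _ ≤ ∫ y, (insertWeight φ x y * freeVolume φ μ (Fin.cons y x : Fin (k + 1) → Euc d)
          + C * insertWeight φ x y) ∂μ := by
        refine integral_mono ((integrable_insertWeight μ hφ x).mul_const _)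
          (hi.add ((integrable_insertWeight μ hφ x).const_mul C)) fun y => ?_
        simp only
        nlinarith [key y, insertWeight_nonneg (φ := φ) x y]
    _ = _ := by
        rw [integral_add hi ((integrable_insertWeight μ hφ x).const_mul C), integral_const_mul]
        rfl

lemma configIntegral_succ_succ (hφ : Measurable φ) (k : ℕ) :
    configIntegral φ μ (k + 2) = ∫ x, pairWeight φ k x * ∫ y, insertWeight φ x y *
      freeVolume φ μ (Fin.cons y x : Fin (k + 1) → Euc d) ∂μ
        ∂Measure.pi (fun _ : Fin k => μ) := by
  rw [configIntegral_succ μ hφ (k + 1), integral_pi_succ μ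
    (g := fun x => pairWeight φ (k + 1) x * freeVolume φ μ x)
    ((measurable_pairWeight hφ (k + 1)).mul (measurable_freeVolume μ hφ)) (M := μ.real Set.univ)]
  · simp only [pairWeight_cons, mul_assoc, integral_const_mul]
  · intro x
    rw [norm_mul, Real.norm_eq_abs (pairWeight φ _ x), abs_of_nonneg (pairWeight_nonneg _ _)]
    exact (mul_le_of_le_one_left (norm_nonneg _) (pairWeight_le_one _ _)).trans
      (norm_freeVolume_le μ hφ _)

/-- Ginibre's inequality, in the form of a nonnegative quadratic polynomial. -/
lemma configIntegral_quadratic_nonneg (hφ : Measurable φ)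
    (hφtemp : Integrable (fun x : Euc d => 1 - expNeg (φ x))) (hμ : μ ≤ volume)
    (k : ℕ) (t : ℝ) :
    0 ≤ configIntegral φ μ (k + 2)
      + ((∫ y : Euc d, (1 - expNeg (φ y))) - 2 * t) * configIntegral φ μ (k + 1)
      + t ^ 2 * configIntegral φ μ k := by
  set C := ∫ y : Euc d, (1 - expNeg (φ y))
  set G : (Fin k → Euc d) → ℝ := fun x => ∫ y, insertWeight φ x y *
      freeVolume φ μ (Fin.cons y x : Fin (k + 1) → Euc d) ∂μ with hG
  have hGm : Measurable G := by
    have : Measurable fun q : (Fin k → Euc d) × Euc d => insertWeight φ q.1 q.2 *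
        freeVolume φ μ (Fin.cons q.2 q.1 : Fin (k + 1) → Euc d) :=
      (measurable_insertWeight hφ).mul
        ((measurable_freeVolume μ hφ).comp (measurable_cons.comp measurable_swap))
    exact (this.stronglyMeasurable.integral_prod_right (ν := μ)).measurable
  have hGb : ∀ x, ‖G x‖ ≤ μ.real Set.univ * μ.real Set.univ := fun x =>
    norm_integral_le_of_norm_le_const (Eventually.of_forall fun y =>
      norm_insertWeight_mul_freeVolume_le μ hφ x y)
  have iG := integrable_pairWeight_mul μ hφ hGm hGb
  have iF := integrable_pairWeight_mul μ hφ (measurable_freeVolume μ hφ (k := k))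
    (norm_freeVolume_le μ hφ)
  have iW : Integrable (pairWeight φ k) (Measure.pi (fun _ : Fin k => μ)) :=
    integrable_of_mem_unit (measurable_pairWeight hφ k) (pairWeight_nonneg k) (pairWeight_le_one k)
  have iS : Integrable (fun x => pairWeight φ k x * G x
      + (C - 2 * t) * (pairWeight φ k x * freeVolume φ μ x)) (Measure.pi (fun _ : Fin k => μ)) :=
    iG.add (iF.const_mul _)
  rw [configIntegral_succ_succ μ hφ, configIntegral_succ μ hφ, configIntegral,
    ← integral_const_mul, ← integral_const_mul, ← integral_add iG (iF.const_mul _),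
    ← integral_add iS (iW.const_mul _)]
  refine integral_nonneg fun x => ?_
  have h := freeVolume_sq_le μ hφ hφtemp hμ x
  have h' : 0 ≤ pairWeight φ k x * (G x + (C - 2 * t) * freeVolume φ μ x + t ^ 2) :=
    mul_nonneg (pairWeight_nonneg _ _) (by
      simp only [hG]
      nlinarith [sq_nonneg (freeVolume φ μ x - t)])
  simp only [Pi.zero_apply]
  linarith

end Integrals

section ExponentialSeries

/-- The exponential generating function of `c`. -/
def expGen (c : ℕ → ℝ) (x : ℝ) : ℝ := ∑' k : ℕ, x ^ k / (Nat.factorial k) * c k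

variable {c : ℕ → ℝ} {M V : ℝ}

lemma summable_expGen_bound (M V x : ℝ) :
    Summable fun k : ℕ => x ^ k / (Nat.factorial k) * (M * V ^ k) := by
  refine ((Real.summable_pow_div_factorial (x * V)).mul_left M).congr fun k => ?_
  rw [mul_pow]; ring

lemma hasSum_expGen (hc : ∀ k, |c k| ≤ M * V ^ k) (x : ℝ) :
    HasSum (fun k : ℕ => x ^ k / (Nat.factorial k) * c k) (expGen c x) := by
  refine (Summable.of_norm_bounded (summable_expGen_bound M V |x|) fun k => ?_).hasSum
  rw [norm_mul, norm_div, norm_pow, Real.norm_eq_abs, Real.norm_eq_abs, Real.norm_eq_abs,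
    Nat.abs_cast]
  exact mul_le_mul_of_nonneg_left (hc k) (by positivity)

lemma shift_bound (hc : ∀ k, |c k| ≤ M * V ^ k) (k : ℕ) : |c (k + 1)| ≤ (M * V) * V ^ k := by
  have := hc (k + 1)
  rwa [pow_succ', ← mul_assoc] at this

lemma succ_div_factorial (x : ℝ) (k : ℕ) :
    ((k + 1 : ℕ) : ℝ) * x ^ k / (Nat.factorial (k + 1)) = x ^ k / (Nat.factorial k) := by
  rw [Nat.factorial_succ, Nat.cast_mul]
  exact mul_div_mul_left _ _ (by positivity)

lemma hasDerivAt_expGen (hc : ∀ k, |c k| ≤ M * V ^ k) (x : ℝ) :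
    HasDerivAt (expGen c) (expGen (fun k => c (k + 1)) x) x := by
  set R := |x| + 1
  have hR : 0 < R := by positivity
  let g' : ℕ → ℝ → ℝ := fun k y => (k : ℝ) * y ^ (k - 1) / (Nat.factorial k) * c k
  have hg'succ : ∀ k y, g' (k + 1) y = y ^ k / (Nat.factorial k) * c (k + 1) := by
    intro k y
    simp only [g', Nat.add_sub_cancel, succ_div_factorial]
  have hu : Summable fun k : ℕ => (k : ℝ) * R ^ (k - 1) / (Nat.factorial k) * |c k| := by
    rw [← summable_nat_add_iff 1]
    refine Summable.of_nonneg_of_le (fun k => by positivity) (fun k => ?_)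
      (summable_expGen_bound (M * V) V R)
    rw [Nat.add_sub_cancel, succ_div_factorial]
    exact mul_le_mul_of_nonneg_left (shift_bound hc k) (by positivity)
  have hd := hasDerivAt_tsum_of_isPreconnected (g := fun k y => y ^ k / (Nat.factorial k) * c k)
    (g' := g') (t := Metric.ball 0 R) (y₀ := x) (y := x) hu Metric.isOpen_ball
    (convex_ball 0 R).isPreconnected
    (fun k y _ => ((hasDerivAt_pow k y).div_const _).mul_const _)
    (fun k y hy => by
      have hy' : |y| ≤ R := by simpa using (Metric.mem_ball.1 hy).le
      simp only [g', norm_mul, norm_div, norm_pow, Real.norm_eq_abs, Nat.abs_cast]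
      gcongr)
    (by simp [R]) (hasSum_expGen hc x).summable (by simp [R])
  have hsum : Summable fun k => g' k x := by
    rw [← summable_nat_add_iff 1]
    simp only [hg'succ]
    exact (hasSum_expGen (shift_bound hc) x).summable
  have htsum : ∑' k, g' k x = expGen (fun k => c (k + 1)) x := by
    rw [hsum.tsum_eq_zero_add, expGen]
    simp only [hg'succ]
    simp [g']
  rw [← htsum]
  exact hd

lemma hasSum_natCast_mul (hc : ∀ k, |c k| ≤ M * V ^ k) (x : ℝ) :
    HasSum (fun k : ℕ => (k : ℝ) * (x ^ k / (Nat.factorial k) * c k))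
      (x * expGen (fun k => c (k + 1)) x) := by
  rw [← hasSum_nat_add_iff' 1]
  simp only [Finset.range_one, Finset.sum_singleton, Nat.cast_zero, zero_mul, sub_zero]
  refine ((hasSum_expGen (shift_bound hc) x).mul_left x).congr_fun fun k => ?_
  rw [← succ_div_factorial x k, pow_succ]
  ring

lemma hasSum_natCast_sq_mul (hc : ∀ k, |c k| ≤ M * V ^ k) (x : ℝ) :
    HasSum (fun k : ℕ => (k : ℝ) ^ 2 * (x ^ k / (Nat.factorial k) * c k))
      (x * (x * expGen (fun k => c (k + 2)) x + expGen (fun k => c (k + 1)) x)) := by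
  rw [← hasSum_nat_add_iff' 1]
  simp only [Finset.range_one, Finset.sum_singleton, Nat.cast_zero, ne_eq, OfNat.ofNat_ne_zero,
    not_false_eq_true, zero_pow, zero_mul, sub_zero]
  refine (((hasSum_natCast_mul (shift_bound hc) x).add
    (hasSum_expGen (shift_bound hc) x)).mul_left x).congr_fun fun k => ?_
  rw [← succ_div_factorial x k, pow_succ]
  push_cast
  ring

/-- Log-convexity of `expGen c` in the variable `log (1 + C x)`, in differential form. -/
lemma expGen_logConvex (hc : ∀ k, |c k| ≤ M * V ^ k) {C : ℝ} (hC : 0 ≤ C)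
    (hquad : ∀ k t, 0 ≤ c (k + 2) + (C - 2 * t) * c (k + 1) + t ^ 2 * c k)
    {x : ℝ} (hx : 0 ≤ x) (hpos : 0 < expGen c x) :
    (1 + C * x) * expGen (fun k => c (k + 1)) x ^ 2 ≤
      expGen c x * ((1 + C * x) * expGen (fun k => c (k + 2)) x
        + C * expGen (fun k => c (k + 1)) x) := by
  set Z := expGen c x
  set Z₁ := expGen (fun k => c (k + 1)) x
  set Z₂ := expGen (fun k => c (k + 2)) x
  set β := (1 + C * x) * Z₁ / Z
  have hc₁ := shift_bound hc
  have hc₂ := shift_bound hc₁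
  have hs := ((((hasSum_expGen hc₂ x).add ((hasSum_expGen hc₁ x).mul_left (C - 2 * β))).add
    ((hasSum_expGen hc x).mul_left (β ^ 2))).add
    (((hasSum_natCast_mul hc₁ x).mul_left (2 * C)).sub
      ((hasSum_natCast_mul hc x).mul_left (2 * β * C)))).add
    ((hasSum_natCast_sq_mul hc x).mul_left (C ^ 2))
  have h0 := hs.nonneg fun k => by
    have h := mul_nonneg (show 0 ≤ x ^ k / (Nat.factorial k : ℝ) by positivity)
      (hquad k (β - C * k))
    linarith
  have hβ : β * Z = (1 + C * x) * Z₁ := div_mul_cancel₀ _ hpos.ne'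
  have h1 : 0 ≤ (1 + C * x) * ((1 + C * x) * Z₂ + C * Z₁) - β ^ 2 * Z := by
    have e : β ^ 2 * Z = β * ((1 + C * x) * Z₁) := by rw [← hβ]; ring
    change 0 ≤ Z₂ + (C - 2 * β) * Z₁ + β ^ 2 * Z + (2 * C * (x * Z₂) - 2 * β * C * (x * Z₁))
      + C ^ 2 * (x * (x * Z₂ + Z₁)) at h0
    rw [e] at h0 ⊢
    linarith
  have hp : 0 < 1 + C * x := by positivity
  have h2 : 0 ≤ (1 + C * x) * (Z * ((1 + C * x) * Z₂ + C * Z₁) - (1 + C * x) * Z₁ ^ 2) := by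
    have := mul_nonneg hpos.le h1
    have e : Z * (β ^ 2 * Z) = ((1 + C * x) * Z₁) ^ 2 := by rw [← hβ]; ring
    nlinarith
  exact sub_nonneg.1 (nonneg_of_mul_nonneg_right h2 hp)

end ExponentialSeries

section LogConvexity

/-- The activity as a function of the convexity parameter `τ = log (1 + C λ) / C`. -/
def activity (C τ : ℝ) : ℝ := (Real.exp (C * τ) - 1) / C

lemma activity_zero (C : ℝ) : activity C 0 = 0 := by simp [activity]

lemma one_add_mul_activity {C : ℝ} (hC : 0 < C) (τ : ℝ) :
    1 + C * activity C τ = Real.exp (C * τ) := by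
  rw [activity, mul_div_cancel₀ _ hC.ne']; ring

lemma activity_nonneg {C τ : ℝ} (hC : 0 < C) (hτ : 0 ≤ τ) : 0 ≤ activity C τ :=
  div_nonneg (sub_nonneg.2 (Real.one_le_exp (by positivity))) hC.le

lemma hasDerivAt_activity {C : ℝ} (hC : 0 < C) (τ : ℝ) :
    HasDerivAt (activity C) (Real.exp (C * τ)) τ := by
  have h := ((((hasDerivAt_id τ).const_mul C).exp).sub_const 1).div_const C
  refine h.congr_deriv ?_
  simp only [id, mul_one]
  exact mul_div_cancel_right₀ _ hC.ne'

lemma expGen_zero (c : ℕ → ℝ) : expGen c 0 = c 0 := by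
  rw [expGen, tsum_eq_single 0 fun k hk => by simp [hk]]
  simp

variable {c : ℕ → ℝ} {M V C : ℝ}

lemma one_le_expGen (hc : ∀ k, |c k| ≤ M * V ^ k) (h0 : ∀ k, 0 ≤ c k) (hc0 : c 0 = 1)
    {x : ℝ} (hx : 0 ≤ x) : 1 ≤ expGen c x := by
  have := le_hasSum (hasSum_expGen hc x) 0 fun k _ => mul_nonneg (by positivity) (h0 k)
  simpa [hc0] using this

lemma hasDerivAt_log_expGen_activity (hc : ∀ k, |c k| ≤ M * V ^ k) (h0 : ∀ k, 0 ≤ c k)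
    (hc0 : c 0 = 1) (hC : 0 < C) {τ : ℝ} (hτ : 0 ≤ τ) :
    HasDerivAt (fun τ => Real.log (expGen c (activity C τ)))
      (expGen (fun k => c (k + 1)) (activity C τ) * Real.exp (C * τ)
        / expGen c (activity C τ)) τ :=
  ((hasDerivAt_expGen hc _).comp τ (hasDerivAt_activity hC τ)).log
    (zero_lt_one.trans_le (one_le_expGen hc h0 hc0 (activity_nonneg hC hτ))).ne'

lemma convexOn_log_expGen_activity (hc : ∀ k, |c k| ≤ M * V ^ k) (h0 : ∀ k, 0 ≤ c k)
    (hc0 : c 0 = 1) (hC : 0 < C)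
    (hquad : ∀ k t, 0 ≤ c (k + 2) + (C - 2 * t) * c (k + 1) + t ^ 2 * c k) :
    ConvexOn ℝ (Set.Ici 0) fun τ => Real.log (expGen c (activity C τ)) := by
  have hpos : ∀ τ, 0 ≤ τ → 0 < expGen c (activity C τ) := fun τ hτ =>
    zero_lt_one.trans_le (one_le_expGen hc h0 hc0 (activity_nonneg hC hτ))
  have hd₁ := fun τ => (hasDerivAt_expGen hc _).comp τ (hasDerivAt_activity hC τ)
  have hd₂ : ∀ τ, HasDerivAt (fun τ => expGen (fun k => c (k + 1)) (activity C τ))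
      (expGen (fun k => c (k + 2)) (activity C τ) * Real.exp (C * τ)) τ := fun τ => (hasDerivAt_expGen (shift_bound hc) _).comp τ (hasDerivAt_activity hC τ)
  have hexp : ∀ τ, HasDerivAt (fun τ => Real.exp (C * τ)) (Real.exp (C * τ) * (C * 1)) τ :=
    fun τ => ((hasDerivAt_id τ).const_mul C).exp
  refine convexOn_of_hasDerivWithinAt2_nonneg (convex_Ici 0)
    (fun τ hτ => (hasDerivAt_log_expGen_activity hc h0 hc0 hC hτ).continuousAt.continuousWithinAt)
    (fun τ hτ => (hasDerivAt_log_expGen_activity hc h0 hc0 hC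
      (interior_subset hτ)).hasDerivWithinAt)
    (fun τ hτ => (((hd₂ τ).mul (hexp τ)).div (hd₁ τ)
      (hpos τ (interior_subset hτ)).ne').hasDerivWithinAt) fun τ hτ => ?_
  have hτ0 : 0 ≤ τ := interior_subset hτ
  have key := expGen_logConvex hc hC.le hquad (activity_nonneg hC hτ0) (hpos τ hτ0)
  rw [one_add_mul_activity hC] at key
  refine div_nonneg ?_ (sq_nonneg _)
  have := mul_nonneg (Real.exp_pos (C * τ)).le (sub_nonneg.2 key)
  simp only [Function.comp, Pi.mul_apply]
  linarith

lemma mul_le_log_expGen_activity (hc : ∀ k, |c k| ≤ M * V ^ k) (h0 : ∀ k, 0 ≤ c k)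
    (hc0 : c 0 = 1) (hC : 0 < C)
    (hquad : ∀ k t, 0 ≤ c (k + 2) + (C - 2 * t) * c (k + 1) + t ^ 2 * c k)
    {τ : ℝ} (hτ : 0 ≤ τ) : c 1 * τ ≤ Real.log (expGen c (activity C τ)) := by
  rcases hτ.eq_or_lt with rfl | hτ'
  · simp [activity_zero, expGen_zero, hc0]
  have h := (convexOn_log_expGen_activity hc h0 hc0 hC hquad).le_slope_of_hasDerivAt
    (Set.self_mem_Ici) hτ hτ' (hasDerivAt_log_expGen_activity hc h0 hc0 hC le_rfl)
  rw [slope_def_field, le_div_iff₀ (by simpa using hτ')] at h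
  simpa [activity_zero, expGen_zero, hc0] using h

end LogConvexity

section FiniteVolume

variable {d : ℕ} {φ : Euc d → ENNReal}

lemma volume_cube (hd : 1 ≤ d) {V : ℝ} (hV : 0 ≤ V) :
    volume (cube d V) = ENNReal.ofReal V := by
  set s := V ^ (1 / (d : ℝ)) / 2 with hs
  have h1 : cube d V = (MeasurableEquiv.toLp 2 (Fin d → ℝ)).symm ⁻¹'
      Set.Icc (fun _ => -s) (fun _ => s) := by
    ext x
    simp [cube, Set.mem_Icc, Pi.le_def, abs_le, forall_and, hs]
  rw [h1, (EuclideanSpace.volume_preserving_symm_measurableEquiv_toLp (Fin d)).measure_preimage_equiv,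
    Real.volume_Icc_pi]
  have h2 : s - -s = V ^ (1 / (d : ℝ)) := by rw [hs]; ring
  simp only [h2, Finset.prod_const, Finset.card_univ, Fintype.card_fin]
  rw [← ENNReal.ofReal_pow (by positivity), one_div,
    Real.rpow_inv_natCast_pow hV (by omega)]

lemma Zreal_eq_expGen (Λ : Set (Euc d)) (lam : ℝ) :
    Zreal φ Λ lam = expGen (configIntegral φ (volume.restrict Λ)) lam := by
  simp only [Zreal, expGen, configIntegral, volume_pi, Measure.restrict_pi_pi]

lemma abs_configIntegral_le {μ : Measure (Euc d)} [IsFiniteMeasure μ] (hφ : Measurable φ) (k : ℕ) :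
    |configIntegral φ μ k| ≤ 1 * μ.real Set.univ ^ k := by
  rw [abs_of_nonneg (configIntegral_nonneg μ k), one_mul]
  exact configIntegral_le_pow μ hφ k

/-- The finite volume pressure in the cube of volume `V`, at activity `activity C τ`. -/
def cubePressure (φ : Euc d → ENNReal) (C V τ : ℝ) : ℝ :=
  V⁻¹ * Real.log (Zreal φ (cube d V) (activity C τ))

lemma isFiniteMeasure_restrict_cube (hd : 1 ≤ d) {V : ℝ} (hV : 0 ≤ V) :
    IsFiniteMeasure ((volume : Measure (Euc d)).restrict (cube d V)) :=
  isFiniteMeasure_restrict.2 (by rw [volume_cube hd hV]; exact ENNReal.ofReal_ne_top)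

lemma convexOn_cubePressure (hd : 1 ≤ d) (hφ : Measurable φ)
    (hφtemp : Integrable (fun x : Euc d => 1 - expNeg (φ x)))
    {C : ℝ} (hC : C = ∫ x : Euc d, (1 - expNeg (φ x))) (hCpos : 0 < C) {V : ℝ} (hV : 0 ≤ V) :
    ConvexOn ℝ (Set.Ici 0) (cubePressure φ C V) := by
  have := isFiniteMeasure_restrict_cube hd hV
  have h := convexOn_log_expGen_activity (abs_configIntegral_le hφ)
    (configIntegral_nonneg (φ := φ) (volume.restrict (cube d V))) (configIntegral_zero _) hCpos
    (by rw [hC]; exact configIntegral_quadratic_nonneg _ hφ hφtemp Measure.restrict_le_self)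
  refine (h.smul (inv_nonneg.2 hV)).congr fun τ _ => ?_
  rw [cubePressure, Zreal_eq_expGen]
  rfl

lemma le_cubePressure (hd : 1 ≤ d) (hφ : Measurable φ)
    (hφtemp : Integrable (fun x : Euc d => 1 - expNeg (φ x)))
    {C : ℝ} (hC : C = ∫ x : Euc d, (1 - expNeg (φ x))) (hCpos : 0 < C) {V : ℝ} (hV : 0 < V)
    {τ : ℝ} (hτ : 0 ≤ τ) : τ ≤ cubePressure φ C V τ := by
  have := isFiniteMeasure_restrict_cube hd hV.le
  have h := mul_le_log_expGen_activity (abs_configIntegral_le hφ)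
    (configIntegral_nonneg (φ := φ) (volume.restrict (cube d V))) (configIntegral_zero _) hCpos
    (by rw [hC]; exact configIntegral_quadratic_nonneg _ hφ hφtemp Measure.restrict_le_self) hτ
  rw [configIntegral_one _ hφ, measureReal_restrict_apply MeasurableSet.univ, Set.univ_inter,
    measureReal_def, volume_cube hd hV.le, ENNReal.toReal_ofReal hV.le] at h
  rwa [cubePressure, Zreal_eq_expGen, le_inv_mul_iff₀ hV]

lemma cubePressure_zero (hd : 1 ≤ d) (C : ℝ) {V : ℝ} (hV : 0 ≤ V) :
    cubePressure φ C V 0 = 0 := by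
  have := isFiniteMeasure_restrict_cube hd hV
  simp [cubePressure, Zreal_eq_expGen, activity_zero, expGen_zero, configIntegral_zero]

end FiniteVolume

section Gluing

variable {R p : ℂ → ℂ} {ρ : ℝ → ℝ} {b S κ : ℝ}

lemma exists_local_factor (hκ : 0 < κ)
    (hp : ∀ x ∈ Set.Ico 0 b, AnalyticAt ℂ p (x : ℂ))
    (hR : ∀ x ∈ Set.Ico 0 b, AnalyticAt ℂ R (x : ℂ))
    (hR' : ∀ x ∈ Set.Ico 0 b, deriv R (x : ℂ) ≠ 0)
    (hρ : ∀ x ∈ Set.Ico 0 b, R (x : ℂ) = (ρ x : ℂ))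
    (hlip : ∀ x ∈ Set.Ico 0 b, ∀ y ∈ Set.Ico 0 b, x < y → κ * (y - x) ≤ ρ y - ρ x)
    {x : ℝ} (hx : x ∈ Set.Ico 0 b) :
    ∃ ε > 0, ∃ g : ℂ → ℂ, AnalyticOnNhd ℂ g (Metric.ball (ρ x : ℂ) ε) ∧
      ∀ y ∈ Set.Ico 0 b, |ρ y - ρ x| < ε → g (ρ y : ℂ) = p (y : ℂ) := by
  have hs := (hR x hx).hasStrictDerivAt
  set q := hs.localInverse _ _ _ (hR' x hx)
  have hq : AnalyticAt ℂ q (R x) := (hR x hx).analyticAt_localInverse (hR' x hx)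
  have hleft := hs.eventually_left_inverse (hR' x hx)
  have hqx : q (R x) = x := hleft.self_of_nhds
  have hpq : AnalyticAt ℂ (p ∘ q) (R x) := AnalyticAt.comp (by rw [hqx]; exact hp x hx) hq
  obtain ⟨ε, hε, hball⟩ := Metric.eventually_nhds_iff_ball.1 hpq.eventually_analyticAt
  obtain ⟨δ, hδ, hinv⟩ := Metric.eventually_nhds_iff_ball.1 hleft
  refine ⟨min ε (κ * δ), by positivity, p ∘ q, fun z hz => hball z ?_, fun y hy hyx => ?_⟩
  · rw [hρ x hx]
    exact Metric.ball_subset_ball (min_le_left _ _) hz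
  · have hdist : κ * |y - x| ≤ |ρ y - ρ x| := by
      rcases lt_trichotomy x y with h | rfl | h
      · rw [abs_of_pos (sub_pos.2 h)]
        exact (hlip x hx y hy h).trans (le_abs_self _)
      · simp
      · rw [abs_sub_comm, abs_of_pos (sub_pos.2 h), abs_sub_comm]
        exact (hlip y hy x hx h).trans (le_abs_self _)
    have hyδ : |y - x| < δ :=
      lt_of_mul_lt_mul_left (hdist.trans_lt (hyx.trans_le (min_le_right _ _))) hκ.le
    have := hinv (y : ℂ) (by
      rw [Metric.mem_ball, Complex.dist_eq, ← Complex.ofReal_sub, Complex.norm_real]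
      exact hyδ)
    rw [Function.comp, ← hρ y hy]
    exact congrArg p this

lemma eqOn_ball_inter_ball {P : ℝ → ℂ} {g₁ g₂ : ℂ → ℂ} {r₁ r₂ ε₁ ε₂ : ℝ}
    (hr₁ : 0 ≤ r₁) (hr₂ : r₂ < S) (hr : r₁ < r₂)
    (hg₁ : AnalyticOnNhd ℂ g₁ (Metric.ball (r₁ : ℂ) ε₁))
    (hg₂ : AnalyticOnNhd ℂ g₂ (Metric.ball (r₂ : ℂ) ε₂))
    (hP₁ : ∀ t ∈ Set.Ico 0 S, |t - r₁| < ε₁ → g₁ (t : ℂ) = P t)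
    (hP₂ : ∀ t ∈ Set.Ico 0 S, |t - r₂| < ε₂ → g₂ (t : ℂ) = P t) :
    Set.EqOn g₁ g₂ (Metric.ball (r₁ : ℂ) ε₁ ∩ Metric.ball (r₂ : ℂ) ε₂) := by
  intro z hz
  have hε₁ : 0 < ε₁ := Metric.pos_of_mem_ball hz.1
  have hε₂ : 0 < ε₂ := Metric.pos_of_mem_ball hz.2
  have hdist : r₂ - r₁ < ε₁ + ε₂ := by
    have h1 := dist_triangle_left (r₁ : ℂ) (r₂ : ℂ) z
    have h2 : dist (r₁ : ℂ) (r₂ : ℂ) = r₂ - r₁ := by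
      rw [dist_comm, Complex.dist_eq, ← Complex.ofReal_sub, Complex.norm_real, Real.norm_eq_abs,
        abs_of_pos (sub_pos.2 hr)]
    have h3 := Metric.mem_ball.1 hz.1
    have h4 := Metric.mem_ball.1 hz.2
    linarith
  have hne : max r₁ (r₂ - ε₂) < min r₂ (r₁ + ε₁) := by
    simp only [max_lt_iff, lt_min_iff]
    exact ⟨⟨hr, by linarith⟩, by linarith, by linarith⟩
  have hmem : ∀ t ∈ Set.Ioo (max r₁ (r₂ - ε₂)) (min r₂ (r₁ + ε₁)),
      t ∈ Set.Ico 0 S ∧ |t - r₁| < ε₁ ∧ |t - r₂| < ε₂ := by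
    rintro t ⟨h1, h2⟩
    rw [max_lt_iff] at h1
    rw [lt_min_iff] at h2
    refine ⟨⟨by linarith, by linarith⟩, abs_lt.2 ⟨by linarith, by linarith⟩,
      abs_lt.2 ⟨by linarith, by linarith⟩⟩
  obtain ⟨t₀, ht₀⟩ := exists_between hne
  have hball : ∀ t r ε : ℝ, |t - r| < ε → (t : ℂ) ∈ Metric.ball (r : ℂ) ε := by
    intro t r ε h
    rwa [Metric.mem_ball, Complex.dist_eq, ← Complex.ofReal_sub, Complex.norm_real]
  refine (hg₁.mono Set.inter_subset_left).eqOn_of_preconnected_of_frequently_eq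
    (hg₂.mono Set.inter_subset_right)
    ((convex_ball _ _).inter (convex_ball _ _)).isPreconnected (z₀ := (t₀ : ℂ))
    ⟨hball _ _ _ (hmem t₀ ht₀).2.1, hball _ _ _ (hmem t₀ ht₀).2.2⟩ ?_ hz
  have htend : Tendsto (fun t : ℝ => (t : ℂ)) (nhdsWithin t₀ (Set.Ioi t₀))
      (nhdsWithin (t₀ : ℂ) {(t₀ : ℂ)}ᶜ) :=
    tendsto_nhdsWithin_iff.2 ⟨Complex.continuous_ofReal.continuousAt.mono_left nhdsWithin_le_nhds,
      eventually_nhdsWithin_of_forall fun t ht => by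
        simpa using (Set.mem_Ioi.1 ht).ne'⟩
  refine htend.frequently (Eventually.frequently ?_)
  filter_upwards [nhdsWithin_le_nhds (Ioo_mem_nhds ht₀.1 ht₀.2)] with t ht
  rw [hP₁ t (hmem t ht).1 (hmem t ht).2.1, hP₂ t (hmem t ht).1 (hmem t ht).2.2]

/-- Analytic functions on balls centered on a real interval which agree on the interval glue to
an analytic function on the union of the balls. -/
lemma exists_glued_analytic {P : ℝ → ℂ} {ε : ℝ → ℝ} {g : ℝ → ℂ → ℂ}
    (hε : ∀ r ∈ Set.Ico 0 S, 0 < ε r)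
    (hg : ∀ r ∈ Set.Ico 0 S, AnalyticOnNhd ℂ (g r) (Metric.ball (r : ℂ) (ε r)))
    (hP : ∀ r ∈ Set.Ico 0 S, ∀ t ∈ Set.Ico 0 S, |t - r| < ε r → g r (t : ℂ) = P t) :
    ∃ D : Set ℂ, ∃ f : ℂ → ℂ, IsOpen D ∧ (∀ r ∈ Set.Ico 0 S, (r : ℂ) ∈ D) ∧
      AnalyticOnNhd ℂ f D ∧
      ∀ z ∈ D, ∃ r ∈ Set.Ico 0 S, z ∈ Metric.ball (r : ℂ) (ε r) ∧ f z = g r z := by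
  classical
  have hagree : ∀ r ∈ Set.Ico 0 S, ∀ s ∈ Set.Ico 0 S, ∀ z ∈ Metric.ball (r : ℂ) (ε r),
      z ∈ Metric.ball (s : ℂ) (ε s) → g r z = g s z := by
    intro r hr s hs z hzr hzs
    rcases lt_trichotomy r s with h | rfl | h
    · exact eqOn_ball_inter_ball hr.1 hs.2 h (hg r hr) (hg s hs) (hP r hr) (hP s hs) ⟨hzr, hzs⟩
    · rfl
    · exact (eqOn_ball_inter_ball hs.1 hr.2 h (hg s hs) (hg r hr) (hP s hs) (hP r hr)
        ⟨hzs, hzr⟩).symm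
  let f : ℂ → ℂ := fun z =>
    if h : ∃ r ∈ Set.Ico 0 S, z ∈ Metric.ball (r : ℂ) (ε r) then g h.choose z else 0
  have hf : ∀ r ∈ Set.Ico 0 S, ∀ z ∈ Metric.ball (r : ℂ) (ε r), f z = g r z := by
    intro r hr z hz
    have h : ∃ r ∈ Set.Ico 0 S, z ∈ Metric.ball (r : ℂ) (ε r) := ⟨r, hr, hz⟩
    simp only [f, dif_pos h]
    exact hagree _ h.choose_spec.1 r hr z h.choose_spec.2 hz
  refine ⟨⋃ r ∈ Set.Ico 0 S, Metric.ball (r : ℂ) (ε r), f,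
    isOpen_biUnion fun _ _ => Metric.isOpen_ball,
    fun r hr => Set.mem_biUnion hr (Metric.mem_ball_self (hε r hr)), fun z hz => ?_,
    fun z hz => ?_⟩
  all_goals obtain ⟨r, hr, hzr⟩ := Set.mem_iUnion₂.1 hz
  · refine (hg r hr z hzr).congr ?_
    filter_upwards [Metric.isOpen_ball.mem_nhds hzr] with w hw using (hf r hr w hw).symm
  · exact ⟨r, hr, hzr, hf r hr z hzr⟩

lemma exists_analytic_factor (hκ : 0 < κ)
    (hp : ∀ x ∈ Set.Ico 0 b, AnalyticAt ℂ p (x : ℂ))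
    (hR : ∀ x ∈ Set.Ico 0 b, AnalyticAt ℂ R (x : ℂ))
    (hR' : ∀ x ∈ Set.Ico 0 b, deriv R (x : ℂ) ≠ 0)
    (hρ : ∀ x ∈ Set.Ico 0 b, R (x : ℂ) = (ρ x : ℂ))
    (hlip : ∀ x ∈ Set.Ico 0 b, ∀ y ∈ Set.Ico 0 b, x < y → κ * (y - x) ≤ ρ y - ρ x)
    (hsurj : ∀ r ∈ Set.Ico 0 S, ∃ x ∈ Set.Ico 0 b, ρ x = r) :
    ∃ D : Set ℂ, IsOpen D ∧ (∀ r : ℝ, r ∈ Set.Ico 0 S → (r : ℂ) ∈ D) ∧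
      ∃ f : ℂ → ℂ, AnalyticOnNhd ℂ f D ∧
        ∀ x : ℝ, x ∈ Set.Ico 0 b → R (x : ℂ) ∈ D → f (R (x : ℂ)) = p (x : ℂ) := by
  choose! ξ hξ hξr using hsurj
  have hloc : ∀ r ∈ Set.Ico 0 S, ∃ ε > 0, ∃ g : ℂ → ℂ,
      AnalyticOnNhd ℂ g (Metric.ball (r : ℂ) ε) ∧
      ∀ y ∈ Set.Ico 0 b, |ρ y - r| < ε → g (ρ y : ℂ) = p (y : ℂ) := by
    intro r hr
    have := exists_local_factor hκ hp hR hR' hρ hlip (hξ r hr)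
    rwa [hξr r hr] at this
  choose! ε hε g hg hgp using hloc
  obtain ⟨D, f, hD, hmem, hf, hfg⟩ := exists_glued_analytic (P := fun t => p (ξ t)) hε hg
    fun r hr t ht htr => by
      have := hgp r hr (ξ t) (hξ t ht)
      rw [hξr t ht] at this
      exact this htr
  refine ⟨D, hD, hmem, f, hf, fun x hx hxD => ?_⟩
  obtain ⟨r, hr, hball, hfr⟩ := hfg _ hxD
  rw [hfr, hρ x hx]
  refine hgp r hr x hx ?_
  rwa [hρ x hx, Metric.mem_ball, Complex.dist_eq, ← Complex.ofReal_sub, Complex.norm_real]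
    at hball

end Gluing

section Density

/-- The value of `τ` at which `activity C τ = lam`. -/
lemma activity_log {C lam : ℝ} (hC : 0 < C) (hlam : 0 ≤ lam) :
    activity C (Real.log (1 + C * lam) / C) = lam := by
  rw [activity, mul_div_cancel₀ _ hC.ne', Real.exp_log (by positivity), add_sub_cancel_left,
    mul_div_cancel_left₀ _ hC.ne']

lemma convexOn_of_tendsto {ι : Type*} {l : Filter ι} [l.NeBot] {s : Set ℝ} (hs : Convex ℝ s)
    {F : ι → ℝ → ℝ} {G : ℝ → ℝ} (hF : ∀ᶠ i in l, ConvexOn ℝ s (F i))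
    (hlim : ∀ x ∈ s, Tendsto (fun i => F i x) l (nhds (G x))) : ConvexOn ℝ s G := by
  refine ⟨hs, fun x hx y hy a b ha hb hab => ?_⟩
  refine le_of_tendsto_of_tendsto (hlim _ (hs hx hy ha hb hab))
    (((hlim x hx).const_smul a).add ((hlim y hy).const_smul b)) ?_
  filter_upwards [hF] with i hi using hi.2 hx hy ha hb hab

variable {p : ℂ → ℂ} {C b : ℝ}

/-- Differential consequences for the infinite volume pressure of the convexity in `τ`. -/
lemma monotone_one_add_mul_deriv (hC : 0 < C)
    (hp : ∀ x ∈ Set.Ico 0 b, DifferentiableAt ℂ p (x : ℂ))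
    (hp0 : p 0 = 0)
    (hconv : ConvexOn ℝ (Set.Ici 0 ∩ activity C ⁻¹' Set.Iio b) fun τ => (p (activity C τ)).re)
    (hle : ∀ τ, 0 ≤ τ → activity C τ < b → τ ≤ (p (activity C τ)).re) :
    (∀ x ∈ Set.Ico 0 b, ∀ y ∈ Set.Ico 0 b, x < y →
      (1 + C * x) * (deriv p x).re ≤ (1 + C * y) * (deriv p y).re) ∧
    ∀ x ∈ Set.Ico 0 b, 1 ≤ (1 + C * x) * (deriv p x).re := by
  set τ : ℝ → ℝ := fun x => Real.log (1 + C * x) / C with hτdef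
  have hact : ∀ x, 0 ≤ x → activity C (τ x) = x := fun x hx => activity_log hC hx
  have hτ0 : ∀ x, 0 ≤ x → 0 ≤ τ x := fun x hx =>
    div_nonneg (Real.log_nonneg (by nlinarith [mul_nonneg hC.le hx])) hC.le
  have hτlt : ∀ x y, 0 ≤ x → x < y → τ x < τ y := fun x y hx hxy =>
    div_lt_div_of_pos_right (Real.log_lt_log (by positivity) (by nlinarith)) hC
  have hmem : ∀ x ∈ Set.Ico 0 b, τ x ∈ Set.Ici 0 ∩ activity C ⁻¹' Set.Iio b := fun x hx =>
    ⟨hτ0 x hx.1, by rw [Set.mem_preimage, hact x hx.1]; exact hx.2⟩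
  have hder : ∀ x ∈ Set.Ico 0 b, HasDerivAt (fun t => (p (activity C t)).re)
      ((1 + C * x) * (deriv p x).re) (τ x) := by
    intro x hx
    have h1 := (hp x hx).hasDerivAt.real_of_complex
    rw [← hact x hx.1] at h1
    have h2 := h1.comp (τ x) (hasDerivAt_activity hC (τ x))
    rw [← one_add_mul_activity hC, hact x hx.1, mul_comm] at h2
    exact h2
  have hmono : ∀ x ∈ Set.Ico 0 b, ∀ y ∈ Set.Ico 0 b, x < y →
      (1 + C * x) * (deriv p x).re ≤ (1 + C * y) * (deriv p y).re := fun x hx y hy hxy =>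
    (hconv.le_slope_of_hasDerivAt (hmem x hx) (hmem y hy) (hτlt x y hx.1 hxy) (hder x hx)).trans
      (hconv.slope_le_of_hasDerivAt (hmem x hx) (hmem y hy) (hτlt x y hx.1 hxy) (hder y hy))
  have hzero : ∀ h0 : (0 : ℝ) ∈ Set.Ico 0 b, 1 ≤ (1 + C * 0) * (deriv p (0 : ℝ)).re := by
    intro h0
    have hτ : τ 0 = 0 := by simp [hτdef]
    have hd := hder 0 h0
    rw [hτ] at hd
    refine ge_of_tendsto ((hasDerivAt_iff_tendsto_slope.1 hd).mono_left
      (nhdsWithin_mono 0 fun y (hy : y ∈ Set.Ioi 0) => ne_of_gt hy)) ?_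
    have hev : ∀ᶠ t in nhds (0 : ℝ), activity C t < b :=
      (hasDerivAt_activity hC 0).continuousAt.eventually_lt continuousAt_const
        (by rw [activity_zero]; exact h0.2)
    filter_upwards [nhdsWithin_le_nhds hev, self_mem_nhdsWithin] with t ht htpos
    rw [slope_def_field, activity_zero, Complex.ofReal_zero, hp0, Complex.zero_re, sub_zero,
      sub_zero]
    exact (one_le_div htpos).2 (hle t (Set.mem_Ioi.1 htpos).le ht)
  refine ⟨hmono, fun x hx => ?_⟩
  have h0 : (0 : ℝ) ∈ Set.Ico 0 b := ⟨le_rfl, hx.1.trans_lt hx.2⟩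
  rcases hx.1.eq_or_lt with rfl | hx0
  · exact hzero h0
  · exact (hzero h0).trans (hmono 0 h0 x hx hx0)

lemma im_deriv_eq_zero (hp : ∀ x ∈ Set.Ico 0 b, DifferentiableAt ℂ p (x : ℂ))
    (hreal : ∀ x ∈ Set.Ico 0 b, (p (x : ℂ)).im = 0) {x : ℝ} (hx : x ∈ Set.Ico 0 b) :
    (deriv p (x : ℂ)).im = 0 := by
  have h1 : HasDerivAt (fun t : ℝ => (p (t : ℂ)).im) (deriv p (x : ℂ)).im x :=
    Complex.imCLM.hasFDerivAt.comp_hasDerivAt x (hp x hx).hasDerivAt.comp_ofReal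
  have h2 : HasDerivWithinAt (fun _ : ℝ => (0 : ℝ)) (deriv p (x : ℂ)).im (Set.Ici x) x := by
    refine h1.hasDerivWithinAt.congr_of_eventuallyEq ?_ (hreal x hx).symm
    filter_upwards [Ico_mem_nhdsGE hx.2] with t ht
    exact (hreal t ⟨hx.1.trans ht.1, ht.2⟩).symm
  exact (uniqueDiffWithinAt_Ici x).eq_deriv _ h2 (hasDerivWithinAt_const x _ 0)

lemma density_sub_ge (hC : 0 < C) {q : ℝ → ℝ}
    (hmono : ∀ x ∈ Set.Ico 0 b, ∀ y ∈ Set.Ico 0 b, x < y →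
      (1 + C * x) * q x ≤ (1 + C * y) * q y)
    (hone : ∀ x ∈ Set.Ico 0 b, 1 ≤ (1 + C * x) * q x)
    {x y : ℝ} (hx : x ∈ Set.Ico 0 b) (hy : y ∈ Set.Ico 0 b) (hxy : x < y) :
    ((1 + C * b) ^ 2)⁻¹ * (y - x) ≤ y * q y - x * q x := by
  have hCx : 0 < 1 + C * x := by have := mul_nonneg hC.le hx.1; linarith
  have hCy : 0 < 1 + C * y := by have := mul_nonneg hC.le hy.1; linarith
  have hb : 1 + C * y ≤ 1 + C * b := by have := mul_le_mul_of_nonneg_left hy.2.le hC.le; linarith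
  have hxb : 1 + C * x ≤ 1 + C * b := by
    have := mul_le_mul_of_nonneg_left hx.2.le hC.le; linarith
  have e : y * q y - x * q x = (y - x) / ((1 + C * x) * (1 + C * y)) * ((1 + C * y) * q y)
      + x / (1 + C * x) * ((1 + C * y) * q y - (1 + C * x) * q x) := by
    rw [div_mul_eq_mul_div, div_mul_eq_mul_div,
      div_add_div _ _ (mul_pos hCx hCy).ne' hCx.ne', eq_div_iff (by positivity)]
    ring
  have h1 : 0 ≤ x / (1 + C * x) * ((1 + C * y) * q y - (1 + C * x) * q x) :=
    mul_nonneg (div_nonneg hx.1 hCx.le) (sub_nonneg.2 (hmono x hx y hy hxy))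
  have h2 : ((1 + C * b) ^ 2)⁻¹ * (y - x) ≤ (y - x) / ((1 + C * x) * (1 + C * y)) := by
    rw [inv_mul_eq_div]
    have := sub_pos.2 hxy
    have := hCx.trans_le hxb
    rw [sq]
    gcongr
  have h3 : (y - x) / ((1 + C * x) * (1 + C * y)) ≤
      (y - x) / ((1 + C * x) * (1 + C * y)) * ((1 + C * y) * q y) :=
    le_mul_of_one_le_right (div_nonneg (sub_pos.2 hxy).le (mul_pos hCx hCy).le) (hone y hy)
  linarith

lemma deriv_ne_zero_of_le_sub {R : ℂ → ℂ} {ρ : ℝ → ℝ} {κ : ℝ} (hκ : 0 < κ)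
    (hρ : ∀ x ∈ Set.Ico 0 b, R (x : ℂ) = (ρ x : ℂ))
    (hlip : ∀ x ∈ Set.Ico 0 b, ∀ y ∈ Set.Ico 0 b, x < y → κ * (y - x) ≤ ρ y - ρ x)
    {x : ℝ} (hx : x ∈ Set.Ico 0 b) (hR : DifferentiableAt ℂ R (x : ℂ)) :
    deriv R (x : ℂ) ≠ 0 := by
  have h1 := hR.hasDerivAt.real_of_complex
  have h2 := (hasDerivAt_iff_tendsto_slope.1 h1).mono_left
    (nhdsWithin_mono x fun y (hy : y ∈ Set.Ioi x) => ne_of_gt hy)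
  have h3 : κ ≤ (deriv R (x : ℂ)).re := by
    refine ge_of_tendsto h2 ?_
    filter_upwards [Ioo_mem_nhdsGT hx.2] with y hy
    have hy' : y ∈ Set.Ico 0 b := ⟨hx.1.trans hy.1.le, hy.2⟩
    rw [slope_def_field, le_div_iff₀ (sub_pos.2 hy.1), hρ x hx, hρ y hy']
    exact hlip x hx y hy' hy.1
  intro h
  rw [h, Complex.zero_re] at h3
  linarith

end Density

/-- Theorem 2: the pressure is analytic as a function of the density
`ρ_φ(λ) = λ p'(λ)` for densities in `[0, (e/(1+e)) / C_φ)`. -/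
theorem pressure_analytic_in_density
    (d : ℕ) (hd : 1 ≤ d)
    (φ : Euc d → ENNReal) (hφmeas : Measurable φ)
    (hφsymm : ∀ x, φ (-x) = φ x)
    (hφtemp : Integrable (fun x : Euc d => 1 - expNeg (φ x)))
    (Cφ : ℝ) (hC : Cφ = ∫ x : Euc d, (1 - expNeg (φ x)))
    (hCpos : 0 < Cφ)
    (Ω : Set ℂ) (hΩ : IsOpen Ω)
    (hΩmem : ∀ lam : ℝ, lam ∈ Set.Ico 0 (Real.exp 1 / Cφ) → (lam : ℂ) ∈ Ω)
    (p : ℂ → ℂ) (hp : AnalyticOnNhd ℂ p Ω)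
    (hconv : ∀ lam : ℝ, lam ∈ Set.Ico 0 (Real.exp 1 / Cφ) →
      Tendsto (fun V : ℝ => ((V⁻¹ * Real.log (Zreal φ (cube d V) lam) : ℝ) : ℂ))
        atTop (nhds (p lam))) :
    (∀ r : ℝ, r ∈ Set.Ico 0 (Real.exp 1 / (1 + Real.exp 1) * (1 / Cφ)) →
      ∃ lam : ℝ, lam ∈ Set.Ico 0 (Real.exp 1 / Cφ) ∧
        (lam : ℂ) * deriv p (lam : ℂ) = (r : ℂ)) ∧
    (∃ D : Set ℂ, IsOpen D ∧
      (∀ r : ℝ, r ∈ Set.Ico 0 (Real.exp 1 / (1 + Real.exp 1) * (1 / Cφ)) → (r : ℂ) ∈ D) ∧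
      ∃ f : ℂ → ℂ, AnalyticOnNhd ℂ f D ∧
        ∀ lam : ℝ, lam ∈ Set.Ico 0 (Real.exp 1 / Cφ) →
          (lam : ℂ) * deriv p (lam : ℂ) ∈ D →
          f ((lam : ℂ) * deriv p (lam : ℂ)) = p (lam : ℂ)) := by
  set b := Real.exp 1 / Cφ with hb
  have hb0 : 0 < b := by positivity
  have hCb : Cφ * b = Real.exp 1 := mul_div_cancel₀ _ hCpos.ne'
  have hpJ : ∀ x ∈ Set.Ico 0 b, AnalyticAt ℂ p (x : ℂ) := fun x hx => hp _ (hΩmem x hx)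
  have hdiff : ∀ x ∈ Set.Ico 0 b, DifferentiableAt ℂ p (x : ℂ) := fun x hx =>
    (hpJ x hx).differentiableAt
  have hre : ∀ x ∈ Set.Ico 0 b,
      Tendsto (fun V : ℝ => V⁻¹ * Real.log (Zreal φ (cube d V) x)) atTop (nhds (p x).re) :=
    fun x hx => (Complex.continuous_re.tendsto _).comp (hconv x hx)
  have hreal : ∀ x ∈ Set.Ico 0 b, (p (x : ℂ)).im = 0 := fun x hx =>
    tendsto_nhds_unique ((Complex.continuous_im.tendsto _).comp (hconv x hx))
      (tendsto_const_nhds.congr fun _ => (Complex.ofReal_im _).symm)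
  have hlim : ∀ τ ∈ Set.Ici 0 ∩ activity Cφ ⁻¹' Set.Iio b,
      Tendsto (fun V => cubePressure φ Cφ V τ) atTop (nhds (p (activity Cφ τ)).re) :=
    fun τ hτ => hre _ ⟨activity_nonneg hCpos hτ.1, hτ.2⟩
  have hmem0 : (0 : ℝ) ∈ Set.Ici 0 ∩ activity Cφ ⁻¹' Set.Iio b :=
    ⟨Set.self_mem_Ici, by rw [Set.mem_preimage, activity_zero]; exact hb0⟩
  have hp0 : p 0 = 0 := by
    have h1 := tendsto_nhds_unique (hlim 0 hmem0) (tendsto_const_nhds.congr' (by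
      filter_upwards [eventually_ge_atTop 0] with V hV
      exact (cubePressure_zero hd Cφ hV).symm))
    have h2 := hreal 0 ⟨le_rfl, hb0⟩
    rw [activity_zero] at h1
    exact Complex.ext (by simpa using h1) (by simpa using h2)
  have hconvex : Convex ℝ (Set.Ici 0 ∩ activity Cφ ⁻¹' Set.Iio b) := by
    have hmono : Monotone (activity Cφ) := fun x y hxy => by
      unfold activity
      gcongr
    exact (convex_Ici 0).inter ((Set.ordConnected_Iio.preimage_mono hmono).convex)
  obtain ⟨hmono, hone⟩ := monotone_one_add_mul_deriv hCpos hdiff hp0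
    (convexOn_of_tendsto hconvex (by
      filter_upwards [eventually_ge_atTop 0] with V hV
      exact (convexOn_cubePressure hd hφmeas hφtemp hC hCpos hV).subset
        Set.inter_subset_left hconvex) hlim)
    fun τ hτ hτb => ge_of_tendsto (hlim τ ⟨hτ, hτb⟩) (by
      filter_upwards [eventually_gt_atTop 0] with V hV
      exact le_cubePressure hd hφmeas hφtemp hC hCpos hV hτ)
  set ρ : ℝ → ℝ := fun x => x * (deriv p x).re with hρdef
  have hρ : ∀ x ∈ Set.Ico 0 b, (x : ℂ) * deriv p (x : ℂ) = (ρ x : ℂ) := by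
    intro x hx
    have := im_deriv_eq_zero hdiff hreal hx
    apply Complex.ext <;> simp [hρdef, this]
  have hlip : ∀ x ∈ Set.Ico 0 b, ∀ y ∈ Set.Ico 0 b, x < y →
      ((1 + Cφ * b) ^ 2)⁻¹ * (y - x) ≤ ρ y - ρ x := fun x hx y hy hxy =>
    density_sub_ge hCpos (q := fun x => (deriv p x).re) hmono hone hx hy hxy
  have hκ : 0 < ((1 + Cφ * b) ^ 2)⁻¹ := by positivity
  have hR : ∀ x ∈ Set.Ico 0 b, AnalyticAt ℂ (fun z => z * deriv p z) (x : ℂ) := fun x hx =>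
    analyticAt_id.mul (hpJ x hx).deriv
  have hcont : ContinuousOn ρ (Set.Ico 0 b) := fun x hx =>
    ((Complex.continuous_re.continuousAt.comp (hR x hx).continuousAt).comp
      Complex.continuous_ofReal.continuousAt).continuousWithinAt.congr
      (fun y hy => by simp [hρdef]) (by simp [hρdef])
  have hsurj : ∀ r ∈ Set.Ico 0 (Real.exp 1 / (1 + Real.exp 1) * (1 / Cφ)),
      ∃ x ∈ Set.Ico 0 b, ρ x = r := by
    intro r hr
    have he := Real.exp_pos 1
    have hr' : r * (Cφ * (1 + Real.exp 1)) < Real.exp 1 := by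
      have := hr.2
      rwa [div_mul_div_comm, mul_one, lt_div_iff₀ (by positivity), mul_comm (1 + _)] at this
    have hrC : 0 < 1 - r * Cφ := by
      have : r * Cφ * (1 + Real.exp 1) < 1 * (1 + Real.exp 1) := by linarith
      linarith [lt_of_mul_lt_mul_right this (by positivity)]
    set x := r / (1 - r * Cφ) with hx
    have hx0 : 0 ≤ x := div_nonneg hr.1 hrC.le
    have hxb : x < b := by
      rw [hx, hb, div_lt_div_iff₀ hrC hCpos]
      linarith
    have hrx : r * (1 + Cφ * x) = x := by
      rw [hx]; field_simp; ring
    have hxpos : 0 < 1 + Cφ * x := by positivity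
    have hle : r ≤ ρ x := by
      have h := mul_le_mul_of_nonneg_left (hone x ⟨hx0, hxb⟩) hx0
      have h' : r * (1 + Cφ * x) ≤ ρ x * (1 + Cφ * x) := by
        rw [hrx, hρdef]
        linarith
      exact le_of_mul_le_mul_right h' hxpos
    obtain ⟨y, hy, hyr⟩ := intermediate_value_Icc hx0
      (hcont.mono fun y hy => ⟨hy.1, hy.2.trans_lt hxb⟩) ⟨by simpa [hρdef] using hr.1, hle⟩
    exact ⟨y, ⟨hy.1, hy.2.trans_lt hxb⟩, hyr⟩
  refine ⟨fun r hr => ?_, ?_⟩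
  · obtain ⟨x, hx, rfl⟩ := hsurj r hr
    exact ⟨x, hx, hρ x hx⟩
  · exact exists_analytic_factor hκ hpJ hR
      (fun x hx => deriv_ne_zero_of_le_sub hκ hρ hlip hx (hR x hx).differentiableAt) hρ hlip hsurj

end
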